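/- Let X be a set and let α, β, θ ∈ P_X be arbitrary partitions over X. Then, writing γ̄ and γ̲ for the kernel and cokernel partitions of γ: (i) #((α·θ)‾ △ (β·θ)‾) ≤ #(ᾱ △ β̄) + 2·rank(α) + 2·rank(β); (ii) #((θ·α)‾ △ (θ·β)‾) ≤ #(ᾱ △ β̄); (iii) #((α·θ)̲ △ (β·θ)̲) ≤ #(α̲ △ β̲); (iv) #((θ·α)̲ △ (θ·β)̲) ≤ #(α̲ △ β̲) + 2·rank(α) + 2·rank(β); (v) #(cl(α·θ) △ cl(β·θ)) ≤ #(cl(α) △ cl(β)); (vi) #(cl(θ·α) △ cl(θ·β)) ≤ #(cl(α) △ cl(β)). (Lemma 4.9 (i)–(vi).) -/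

import Mathlib

open Cardinal
open scoped symmDiff

namespace PartitionCongruences

variable {X : Type*}

/-- A partition over `X` is a setoid on `X ⊕ X`; `PMon X` is the carrier of the
partition monoid. -/
abbrev PMon (X : Type*) := Setoid (X ⊕ X)

/-- The set of blocks of a partition. -/
def cl (α : PMon X) : Set (Set (X ⊕ X)) := α.classes

/-- A block of `α` is a transversal if it meets both summands. -/
def IsTransversal (α : PMon X) (B : Set (X ⊕ X)) : Prop :=
  B ∈ α.classes ∧ (∃ x : X, Sum.inl x ∈ B) ∧ (∃ x : X, Sum.inr x ∈ B)

/-- The rank of a partition: the number of its transversals. -/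
def rank (α : PMon X) : Cardinal :=
  #{B : Set (X ⊕ X) // IsTransversal α B}

/-- The kernel partition `ᾱ`. -/
def ker (α : PMon X) : Set (Set X) := (Setoid.comap Sum.inl α).classes

/-- The cokernel partition `α̲`. -/
def coker (α : PMon X) : Set (Set X) := (Setoid.comap Sum.inr α).classes

/-- Left summand to top copy, right summand to middle copy. -/
def dmap (X : Type*) : X ⊕ X → X ⊕ (X ⊕ X) :=
  Sum.elim Sum.inl (fun x => Sum.inr (Sum.inl x))

/-- Left summand to middle copy, right summand to bottom copy. -/
def umap (X : Type*) : X ⊕ X → X ⊕ (X ⊕ X) :=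
  Sum.elim (fun x => Sum.inr (Sum.inl x)) (fun x => Sum.inr (Sum.inr x))

/-- Left summand to top copy, right summand to bottom copy. -/
def emap (X : Type*) : X ⊕ X → X ⊕ (X ⊕ X) :=
  Sum.elim Sum.inl (fun x => Sum.inr (Sum.inr x))

/-- The pushforward of a setoid along a map: the smallest setoid relating `f x` and
`f y` whenever `σ` relates `x` and `y`. -/
def push {A B : Type*} (f : A → B) (σ : Setoid A) : Setoid B :=
  Relation.EqvGen.setoid (fun a b => ∃ x y, σ x y ∧ f x = a ∧ f y = b)

/-- The product of the partition monoid. -/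
instance : Mul (PMon X) :=
  ⟨fun α β => Setoid.comap (emap X) (push (dmap X) α ⊔ push (umap X) β)⟩


universe u

theorem push_le_iff {A B : Type*} {f : A → B} {σ : Setoid A} {τ : Setoid B} :
    push f σ ≤ τ ↔ ∀ x y, σ x y → τ (f x) (f y) := by
  constructor
  · intro h x y hxy
    exact h (Relation.EqvGen.rel _ _ ⟨x, y, hxy, rfl, rfl⟩)
  · intro h
    refine Setoid.eqvGen_le ?_
    rintro _ _ ⟨x, y, hxy, rfl, rfl⟩
    exact h x y hxy

theorem push_sup_push_le_iff {A B C : Type*} {f : A → C} {g : B → C} {σ : Setoid A}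
    {τ : Setoid B} {ρ : Setoid C} :
    push f σ ⊔ push g τ ≤ ρ ↔
      (∀ x y, σ x y → ρ (f x) (f y)) ∧ ∀ x y, τ x y → ρ (g x) (g y) := by
  rw [sup_le_iff, push_le_iff, push_le_iff]

theorem mem_iff_of_le_comap {Y : Type*} {σ : Setoid Y} {P : Y → Prop}
    (h : σ ≤ Setoid.comap P ⊥) {x y : Y} (hxy : σ x y) : P x ↔ P y :=
  iff_of_eq (h hxy)

theorem comap_bot_apply {Y : Type*} {P : Y → Prop} {x y : Y} (h : P x ↔ P y) :
    Setoid.comap P ⊥ x y := propext h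

theorem setOf_rel_mem_classes_iff {Z : Type*} {α β : Setoid Z} {z : Z} :
    {w | α w z} ∈ β.classes ↔ ∀ w, α w z ↔ β w z := by
  constructor
  · rintro ⟨y, hy⟩ w
    have hz : β z y := hy.subset (α.refl' z)
    constructor
    · intro h
      have hw : β w y := hy.subset h
      exact β.trans' hw (β.symm' hz)
    · intro h
      exact hy.superset (β.trans' h hz)
  · intro h
    exact ⟨z, Set.ext h⟩

section Components

variable {Y Z : Type*} {σ : Setoid Y} {f : Z → Y} {α β : Setoid Z}

/-- A connected component of `σ ⊔ push f α` all of whose `α`-blocks are `β`-blocks is also a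
connected component of `σ ⊔ push f β`. -/
theorem sup_push_apply_iff {y : Y}
    (h : ∀ z, (σ ⊔ push f α) (f z) y → {w | α w z} ∈ β.classes) (x : Y) :
    (σ ⊔ push f α) x y ↔ (σ ⊔ push f β) x y := by
  set E := σ ⊔ push f α
  set F := σ ⊔ push f β
  have hσE : σ ≤ E := le_sup_left
  have hσF : σ ≤ F := le_sup_left
  have hαE : ∀ z w, α z w → E (f z) (f w) := push_le_iff.1 le_sup_right
  have hβF : ∀ z w, β z w → F (f z) (f w) := push_le_iff.1 le_sup_right
  have key : ∀ z, E (f z) y → ∀ w, α w z ↔ β w z :=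
    fun z hz => setOf_rel_mem_classes_iff.1 (h z hz)
  have back : ∀ x, F x y → E x y := by
    have : F ≤ Setoid.comap (fun x => E x y) ⊥ := by
      refine sup_le ?_ (push_le_iff.2 ?_)
      · intro a b hab
        exact comap_bot_apply
          ⟨fun ha => E.trans' (E.symm' (hσE hab)) ha, fun hb => E.trans' (hσE hab) hb⟩
      · intro z w hzw
        refine comap_bot_apply ⟨fun hz => ?_, fun hw => ?_⟩
        · exact E.trans' (hαE _ _ ((key z hz w).2 (β.symm' hzw))) hz
        · exact E.trans' (hαE _ _ ((key w hw z).2 hzw)) hw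
    intro x hx
    exact (mem_iff_of_le_comap this hx).2 (E.refl' y)
  refine ⟨fun hx => ?_, back x⟩
  have : E ≤ Setoid.comap (fun x => F x y) ⊥ := by
    refine sup_le ?_ (push_le_iff.2 ?_)
    · intro a b hab
      exact comap_bot_apply
        ⟨fun ha => F.trans' (F.symm' (hσF hab)) ha, fun hb => F.trans' (hσF hab) hb⟩
    · intro z w hzw
      refine comap_bot_apply ⟨fun hz => ?_, fun hw => ?_⟩
      · exact F.trans' (hβF _ _ ((key z (back _ hz) w).1 (α.symm' hzw))) hz
      · exact F.trans' (hβF _ _ ((key w (back _ hw) z).1 hzw)) hw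
  exact (mem_iff_of_le_comap this hx).2 (F.refl' y)

end Components

theorem mk_classes_comap_diff_le {Y Z W : Type u} (σ : Setoid Y) (f : Z → Y) (α β : Setoid Z)
    (e : W → Y) :
    #↥((Setoid.comap e (σ ⊔ push f α)).classes \ (Setoid.comap e (σ ⊔ push f β)).classes) ≤
      #↥(α.classes \ β.classes) := by
  have hαE : ∀ z w, α z w → (σ ⊔ push f α) (f z) (f w) := push_le_iff.1 le_sup_right
  have H : ∀ C : ↥((Setoid.comap e (σ ⊔ push f α)).classes \
      (Setoid.comap e (σ ⊔ push f β)).classes), ∃ w z,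
      C.1 = {v | Setoid.comap e (σ ⊔ push f α) v w} ∧ (σ ⊔ push f α) (f z) (e w) ∧
        {v | α v z} ∉ β.classes := by
    rintro ⟨C, ⟨w, rfl⟩, hC⟩
    by_contra! hcon
    refine hC ⟨w, Set.ext fun v => ?_⟩
    exact sup_push_apply_iff (fun z hz => hcon w z rfl hz) (e v)
  choose w z hC hzw hz using H
  refine mk_le_of_injective
    (f := fun C => (⟨{v | α v (z C)}, ⟨z C, rfl⟩, hz C⟩ : ↥(α.classes \ β.classes))) ?_
  intro C D hCD
  have hzz : α (z C) (z D) := (Subtype.ext_iff.1 hCD).subset (α.refl' (z C))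
  have hww : Setoid.comap e (σ ⊔ push f α) (w C) (w D) :=
    (σ ⊔ push f α).trans' ((σ ⊔ push f α).symm' (hzw C))
      ((σ ⊔ push f α).trans' (hαE _ _ hzz) (hzw D))
  refine Subtype.ext ?_
  rw [hC C, hC D]
  ext v
  exact ⟨fun h => Setoid.trans' _ h hww, fun h => Setoid.trans' _ h (Setoid.symm' _ hww)⟩

theorem mk_symmDiff_eq {A : Type u} (s t : Set A) : #↥(s ∆ t) = #↥(s \ t) + #↥(t \ s) :=
  mk_union_of_disjoint disjoint_sdiff_sdiff

theorem mk_symmDiff_classes_comap_le {Y Z W : Type u} (σ : Setoid Y) (f : Z → Y)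
    (α β : Setoid Z) (e : W → Y) :
    #↥((Setoid.comap e (σ ⊔ push f α)).classes ∆ (Setoid.comap e (σ ⊔ push f β)).classes) ≤
      #↥(α.classes ∆ β.classes) := by
  rw [mk_symmDiff_eq, mk_symmDiff_eq]
  exact add_le_add (mk_classes_comap_diff_le σ f α β e) (mk_classes_comap_diff_le σ f β α e)

theorem mul_def (α β : PMon X) :
    α * β = Setoid.comap (emap X) (push (dmap X) α ⊔ push (umap X) β) := rfl

/-- The kernel of `θ * α` only depends on `θ` and on the kernel of `α`. -/
theorem comap_inl_mul (θ α : PMon X) :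
    Setoid.comap Sum.inl (θ * α) =
      Setoid.comap Sum.inl (push (dmap X) θ ⊔
        push (fun x : X => (Sum.inr (Sum.inl x) : X ⊕ (X ⊕ X))) (Setoid.comap Sum.inl α)) := by
  set G := push (dmap X) θ ⊔
    push (fun x : X => (Sum.inr (Sum.inl x) : X ⊕ (X ⊕ X))) (Setoid.comap Sum.inl α)
  have hθ : ∀ a b, θ a b → G (dmap X a) (dmap X b) := push_le_iff.1 le_sup_left
  have hα : ∀ a b, α (Sum.inl a) (Sum.inl b) → G (Sum.inr (Sum.inl a)) (Sum.inr (Sum.inl b)) :=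
    push_le_iff.1 (le_sup_right : _ ≤ G)
  apply le_antisymm
  · intro t s hts
    let P : X ⊕ (X ⊕ X) → Prop := Sum.elim (fun x => G (Sum.inl x) (Sum.inl s))
      (Sum.elim (fun x => G (Sum.inr (Sum.inl x)) (Sum.inl s))
        (fun x => ∃ z, α (Sum.inl z) (Sum.inr x) ∧ G (Sum.inr (Sum.inl z)) (Sum.inl s)))
    have hP : ∀ a, P (dmap X a) ↔ G (dmap X a) (Sum.inl s) := by
      rintro (a | a) <;> exact Iff.rfl
    have hmem : push (dmap X) θ ⊔ push (umap X) α ≤ Setoid.comap P ⊥ := by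
      refine push_sup_push_le_iff.2 ⟨fun a b hab => comap_bot_apply ?_, fun a b hab =>
        comap_bot_apply ?_⟩
      · rw [hP, hP]
        exact ⟨fun h => G.trans' (G.symm' (hθ _ _ hab)) h, fun h => G.trans' (hθ _ _ hab) h⟩
      · have step : ∀ a b, α a b → P (umap X a) → P (umap X b) := by
          rintro (a | a) (b | b) hab h
          · exact G.trans' (G.symm' (hα _ _ hab)) h
          · exact ⟨a, hab, h⟩
          · obtain ⟨z, hz, h⟩ := h
            exact G.trans' (G.symm' (hα _ _ (α.trans' hz hab))) h
          · obtain ⟨z, hz, h⟩ := h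
            exact ⟨z, α.trans' hz hab, h⟩
        exact ⟨step a b hab, step b a (α.symm' hab)⟩
    exact (mem_iff_of_le_comap hmem hts).2 (G.refl' _)
  · have : G ≤ push (dmap X) θ ⊔ push (umap X) α :=
      sup_le le_sup_left
        (push_le_iff.2 fun a b hab => push_le_iff.1 (le_sup_right : push (umap X) α ≤ _) _ _ hab)
    intro t s hts
    exact this hts

/-- The involution of the partition monoid. -/
abbrev invol (α : PMon X) : PMon X := Setoid.comap Sum.swap α

theorem invol_apply (α : PMon X) (a b : X ⊕ X) : invol α a b ↔ α a.swap b.swap := Iff.rfl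

theorem invol_invol (α : PMon X) : invol (invol α) = α := by
  ext a b
  simp [invol_apply]

theorem invol_mul_le (α β : PMon X) : invol (α * β) ≤ invol β * invol α := by
  let s : X ⊕ (X ⊕ X) → X ⊕ (X ⊕ X) := Sum.elim (fun x => Sum.inr (Sum.inr x))
    (Sum.elim (fun x => Sum.inr (Sum.inl x)) Sum.inl)
  have hd : ∀ a, s (dmap X a) = umap X a.swap := by rintro (a | a) <;> rfl
  have hu : ∀ a, s (umap X a) = dmap X a.swap := by rintro (a | a) <;> rfl
  have he : ∀ a, s (emap X a.swap) = emap X a := by rintro (a | a) <;> rfl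
  have h : push (dmap X) α ⊔ push (umap X) β ≤
      Setoid.comap s (push (dmap X) (invol β) ⊔ push (umap X) (invol α)) := by
    refine push_sup_push_le_iff.2 ⟨fun a b hab => ?_, fun a b hab => ?_⟩
    · rw [Setoid.comap_rel, hd, hd]
      refine push_le_iff.1 le_sup_right _ _ ?_
      simpa [invol_apply] using hab
    · rw [Setoid.comap_rel, hu, hu]
      refine push_le_iff.1 le_sup_left _ _ ?_
      simpa [invol_apply] using hab
  intro a b hab
  have := h hab
  rwa [Setoid.comap_rel, he, he] at this

theorem invol_mul (α β : PMon X) : invol (α * β) = invol β * invol α := by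
  refine le_antisymm (invol_mul_le α β) ?_
  have h := invol_mul_le (invol β) (invol α)
  rw [invol_invol, invol_invol] at h
  intro a b hab
  refine h ?_
  simpa [invol_apply] using hab

theorem ker_invol (α : PMon X) : ker (invol α) = coker α := rfl

theorem rank_invol_le (α : PMon X) : rank (invol α) ≤ rank α := by
  refine mk_le_of_injective (f := fun B => ⟨Sum.swap ⁻¹' B.1, ?_, ?_, ?_⟩) ?_
  · obtain ⟨⟨a, ha⟩, -⟩ := B.2
    refine ⟨a.swap, ?_⟩
    rw [ha]
    ext b
    simp [invol_apply]
  · exact B.2.2.2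
  · exact B.2.2.1
  · intro B C h
    exact Subtype.ext (Sum.swap_rightInverse.surjective.preimage_injective (Subtype.ext_iff.1 h))

/-- At most `rank α` classes of a setoid coarser than the kernel of `α` meet a transversal. -/
theorem mk_classes_meeting_transversal_le {α : PMon X} {κ : Setoid X}
    (h : Setoid.comap Sum.inl α ≤ κ) :
    #↥{C ∈ κ.classes | ∃ x ∈ C, ∃ z, α (Sum.inr z) (Sum.inl x)} ≤ rank α := by
  have H : ∀ C : ↥{C ∈ κ.classes | ∃ x ∈ C, ∃ z, α (Sum.inr z) (Sum.inl x)},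
      ∃ x, C.1 = {y | κ y x} ∧ ∃ z, α (Sum.inr z) (Sum.inl x) := by
    rintro ⟨C, ⟨y, rfl⟩, x, hx, hz⟩
    refine ⟨x, ?_, hz⟩
    ext v
    exact ⟨fun h => κ.trans' h (κ.symm' hx), fun h => κ.trans' h hx⟩
  choose x hx hz using H
  refine mk_le_of_injective
    (f := fun C => ⟨{b | α b (Sum.inl (x C))}, ⟨_, rfl⟩, ⟨x C, α.refl' _⟩, hz C⟩) ?_
  intro C D hCD
  have hxx : κ (x C) (x D) :=
    h ((Subtype.ext_iff.1 hCD).subset (α.refl' (Sum.inl (x C))))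
  refine Subtype.ext ?_
  rw [hx C, hx D]
  ext v
  exact ⟨fun h => κ.trans' h hxx, fun h => κ.trans' h (κ.symm' hxx)⟩

theorem comap_inl_le_mul (α θ : PMon X) :
    Setoid.comap Sum.inl α ≤ Setoid.comap Sum.inl (α * θ) := fun _ _ h =>
  push_le_iff.1 (le_sup_left : push (dmap X) α ≤ push (dmap X) α ⊔ push (umap X) θ) _ _ h

/-- A kernel class of `α` not contained in a transversal is a kernel class of `α * θ`. -/
theorem mul_inl_iff_of_not_transversal {α : PMon X} {x : X}
    (hx : ¬ ∃ z, α (Sum.inr z) (Sum.inl x)) (θ : PMon X) (y : X) :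
    (α * θ) (Sum.inl y) (Sum.inl x) ↔ α (Sum.inl y) (Sum.inl x) := by
  refine ⟨fun hyx => ?_, fun h => comap_inl_le_mul α θ h⟩
  let P : X ⊕ (X ⊕ X) → Prop := Sum.elim (fun y => α (Sum.inl y) (Sum.inl x)) (fun _ => False)
  have hP : ∀ a, P (dmap X a) ↔ α a (Sum.inl x) := by
    rintro (a | a)
    · exact Iff.rfl
    · exact ⟨False.elim, fun h => hx ⟨a, h⟩⟩
  have hu : ∀ a, ¬ P (umap X a) := by rintro (a | a) <;> exact id
  have hmem : push (dmap X) α ⊔ push (umap X) θ ≤ Setoid.comap P ⊥ := by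
    refine push_sup_push_le_iff.2 ⟨fun a b hab => comap_bot_apply ?_, fun a b hab =>
      comap_bot_apply (iff_of_false (hu a) (hu b))⟩
    rw [hP, hP]
    exact ⟨fun h => α.trans' (α.symm' hab) h, fun h => α.trans' hab h⟩
  exact (mem_iff_of_le_comap hmem hyx).2 (α.refl' _)

theorem mk_ker_mul_right_diff_le (α β θ : PMon X) :
    #↥(ker (α * θ) \ ker (β * θ)) ≤ #↥(ker α \ ker β) + rank α + rank β := by
  have hsub : ker (α * θ) \ ker (β * θ) ⊆ (ker α \ ker β) ∪
      {C ∈ ker (α * θ) | ∃ x ∈ C, ∃ z, α (Sum.inr z) (Sum.inl x)} ∪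
      {C ∈ ker β | ∃ x ∈ C, ∃ z, β (Sum.inr z) (Sum.inl x)} := by
    rintro C ⟨hC, hC'⟩
    by_cases hα : ∃ x ∈ C, ∃ z, α (Sum.inr z) (Sum.inl x)
    · exact Or.inl (Or.inr ⟨hC, hα⟩)
    obtain ⟨x, rfl⟩ := hC
    have hxα : ¬ ∃ z, α (Sum.inr z) (Sum.inl x) := fun h =>
      hα ⟨x, (Setoid.comap Sum.inl (α * θ)).refl' x, h⟩
    have hCα : {y | Setoid.comap Sum.inl (α * θ) y x} = {y | Setoid.comap Sum.inl α y x} :=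
      Set.ext (mul_inl_iff_of_not_transversal hxα θ)
    rw [hCα] at hC' ⊢
    by_cases hCβ : {y | Setoid.comap Sum.inl α y x} ∈ ker β
    · refine Or.inr ⟨hCβ, x, α.refl' (Sum.inl x), ?_⟩
      by_contra hxβ
      refine hC' (setOf_rel_mem_classes_iff.2 fun y => ?_)
      exact (setOf_rel_mem_classes_iff.1 hCβ y).trans
        (mul_inl_iff_of_not_transversal hxβ θ y).symm
    · exact Or.inl (Or.inl ⟨⟨x, rfl⟩, hCβ⟩)
  refine (mk_le_mk_of_subset hsub).trans ((mk_union_le _ _).trans (add_le_add ?_ ?_))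
  · exact (mk_union_le _ _).trans
      (add_le_add le_rfl (mk_classes_meeting_transversal_le (comap_inl_le_mul α θ)))
  · exact mk_classes_meeting_transversal_le le_rfl

theorem mk_ker_mul_right_symmDiff_le (α β θ : PMon X) :
    #↥(ker (α * θ) ∆ ker (β * θ)) ≤ #↥(ker α ∆ ker β) + 2 * rank α + 2 * rank β := by
  rw [mk_symmDiff_eq, mk_symmDiff_eq]
  refine (add_le_add (mk_ker_mul_right_diff_le α β θ)
    (mk_ker_mul_right_diff_le β α θ)).trans_eq ?_
  ring

theorem mk_ker_mul_left_symmDiff_le (α β θ : PMon X) :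
    #↥(ker (θ * α) ∆ ker (θ * β)) ≤ #↥(ker α ∆ ker β) := by
  unfold ker
  rw [comap_inl_mul, comap_inl_mul]
  exact mk_symmDiff_classes_comap_le _ _ _ _ _

/-- Lemma 4.9 (i)–(vi): bounds on symmetric differences of kernels, cokernels and
block-sets under multiplication in the partition monoid. -/
theorem symmDiff_mul_bounds (α β θ : PMon X) :
    #↥(ker (α * θ) ∆ ker (β * θ)) ≤ #↥(ker α ∆ ker β) + 2 * rank α + 2 * rank β ∧
    #↥(ker (θ * α) ∆ ker (θ * β)) ≤ #↥(ker α ∆ ker β) ∧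
    #↥(coker (α * θ) ∆ coker (β * θ)) ≤ #↥(coker α ∆ coker β) ∧
    #↥(coker (θ * α) ∆ coker (θ * β)) ≤ #↥(coker α ∆ coker β) + 2 * rank α + 2 * rank β ∧
    #↥(cl (α * θ) ∆ cl (β * θ)) ≤ #↥(cl α ∆ cl β) ∧
    #↥(cl (θ * α) ∆ cl (θ * β)) ≤ #↥(cl α ∆ cl β) := by
  refine ⟨mk_ker_mul_right_symmDiff_le α β θ, mk_ker_mul_left_symmDiff_le α β θ, ?_, ?_, ?_, ?_⟩
  · simp only [← ker_invol, invol_mul]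
    exact mk_ker_mul_left_symmDiff_le _ _ _
  · simp only [← ker_invol, invol_mul]
    refine (mk_ker_mul_right_symmDiff_le _ _ _).trans ?_
    gcongr <;> exact rank_invol_le _
  · simp only [cl, mul_def, sup_comm _ (push (umap X) θ)]
    exact mk_symmDiff_classes_comap_le _ _ _ _ _
  · exact mk_symmDiff_classes_comap_le _ _ _ _ _

end PartitionCongruences
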